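/- arXiv:2411.14882 — 4 statements merged into one kernel-verified Lean document; each statement's English description precedes it below -/
import Mathlib

section
/- Let a, b > 0 and 0 < r ≤ 2√a/b, and set γ₊ = (−b r² + i·r·√(4a − b²r²))/2. Then the real part of γ₊ equals −b r²/2 exactly, and the imaginary part of γ₊ satisfies |Im γ₊ − √a · r| ≤ (b²/(4√a)) · r³. -/
/-- Quantitative low-frequency expansion of the characteristic eigenvalue
`γ₊ = (−b r² + i r √(4a − b²r²))/2`: its real part is exactly `−b r²/2` and its
imaginary part differs from `√a · r` by at most `(b²/(4√a)) r³`. -/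
theorem stmt5 (a b r : ℝ) (ha : 0 < a) (hb : 0 < b) (hr : 0 < r)
    (hr2 : r ≤ 2 * Real.sqrt a / b)
    (γp : ℂ)
    (hγp : γp = (-(b : ℂ) * r ^ 2 + Complex.I * r * (Real.sqrt (4 * a - b ^ 2 * r ^ 2) : ℝ)) / 2) :
    γp.re = -(b * r ^ 2) / 2 ∧
    |γp.im - Real.sqrt a * r| ≤ b ^ 2 / (4 * Real.sqrt a) * r ^ 3 := by
  have hγ : γp = ((-(b * r ^ 2) / 2 : ℝ) : ℂ) +
      ((r * Real.sqrt (4 * a - b ^ 2 * r ^ 2) / 2 : ℝ) : ℂ) * Complex.I := by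
    rw [hγp]
    push_cast
    ring
  have hre : γp.re = -(b * r ^ 2) / 2 := by
    simp only [hγ, Complex.add_re, Complex.re_ofReal_mul, Complex.ofReal_re, Complex.I_re,
      mul_zero, add_zero]
  have him : γp.im = r * Real.sqrt (4 * a - b ^ 2 * r ^ 2) / 2 := by
    simp only [hγ, Complex.add_im, Complex.im_ofReal_mul, Complex.ofReal_im, Complex.I_im,
      mul_one, zero_add]
  refine ⟨hre, ?_⟩
  rw [him]
  have hs : 0 < Real.sqrt a := Real.sqrt_pos.mpr ha
  have hs2 : Real.sqrt a ^ 2 = a := Real.sq_sqrt ha.le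
  have hbr : r * b ≤ 2 * Real.sqrt a := (le_div_iff₀ hb).mp hr2
  have hdisc : 0 ≤ 4 * a - b ^ 2 * r ^ 2 := by
    nlinarith [mul_pos hr hb]
  have ht2 := Real.sq_sqrt hdisc
  have ht := Real.sqrt_nonneg (4 * a - b ^ 2 * r ^ 2)
  generalize Real.sqrt (4 * a - b ^ 2 * r ^ 2) = t at ht ht2 ⊢
  generalize Real.sqrt a = s at hs hs2 hbr ⊢
  have hts : t ≤ 2 * s := by
    refine (abs_le_of_sq_le_sq' ?_ (by positivity)).2
    nlinarith [sq_nonneg (b * r)]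
  have hdiff : s - t / 2 ≤ b ^ 2 * r ^ 2 / (4 * s) := by
    rw [le_div_iff₀ (by positivity)]
    nlinarith [mul_le_mul_of_nonneg_left hts ht]
  rw [abs_sub_comm, abs_of_nonneg (by nlinarith)]
  calc s * r - r * t / 2 = (s - t / 2) * r := by ring
    _ ≤ b ^ 2 * r ^ 2 / (4 * s) * r := mul_le_mul_of_nonneg_right hdiff hr.le
    _ = b ^ 2 / (4 * s) * r ^ 3 := by ring
end

section
/- Let a, b > 0 and r ≥ 2√(2a)/b, and set γ₊ = (−b r² + √(b²r⁴ − 4a r²))/2 (which is real since b²r² ≥ 8a > 4a). Then |γ₊ + a/b| ≤ 8a²/(b³ r²). -/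
/-- Two-sided second-order bound for `√(B² − 4eB)` when `B` dominates `e`. -/
theorem abs_sqrt_sq_sub_four_mul_le {e B : ℝ} (he : 0 < e) (hB : 8 * e ≤ B) :
    |(-B + Real.sqrt (B ^ 2 - 4 * (e * B))) / 2 + e| ≤ 8 * e ^ 2 / B := by
  have hBpos : 0 < B := by linarith
  obtain ⟨t, ht⟩ : ∃ t, t = e ^ 2 / B := ⟨_, rfl⟩
  have htB : t * B = e ^ 2 := by rw [ht]; field_simp
  have ht0 : 0 < t := by rw [ht]; positivity
  have hte : 8 * t ≤ e := by
    have h : 8 * t * B ≤ e * B := by nlinarith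
    exact le_of_mul_le_mul_right h hBpos
  have upper : Real.sqrt (B ^ 2 - 4 * (e * B)) ≤ B - 2 * e :=
    Real.sqrt_le_iff.mpr ⟨by linarith, by nlinarith [sq_nonneg e]⟩
  have lower : B - 2 * e - 16 * t ≤ Real.sqrt (B ^ 2 - 4 * (e * B)) := by
    apply Real.le_sqrt_of_sq_le
    nlinarith [mul_le_mul_of_nonneg_left hte he.le, mul_le_mul_of_nonneg_left hte ht0.le]
  have hrhs : 8 * e ^ 2 / B = 8 * t := by rw [ht]; ring
  rw [hrhs, abs_le]
  constructor <;> linarith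

/-- Quantitative high-frequency Laurent expansion of the larger characteristic eigenvalue:
for `r ≥ 2√(2a)/b` and `γ₊ = (−b r² + √(b²r⁴ − 4a r²))/2`, one has
`|γ₊ + a/b| ≤ 8a²/(b³ r²)`. -/
theorem stmt6 (a b r : ℝ) (ha : 0 < a) (hb : 0 < b)
    (hr : 2 * Real.sqrt (2 * a) / b ≤ r)
    (γp : ℝ)
    (hγp : γp = (-(b * r ^ 2) + Real.sqrt (b ^ 2 * r ^ 4 - 4 * a * r ^ 2)) / 2) :
    |γp + a / b| ≤ 8 * a ^ 2 / (b ^ 3 * r ^ 2) := by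
  have hsqrt : 0 < Real.sqrt (2 * a) := Real.sqrt_pos.mpr (by positivity)
  have hr0 : 0 < r := lt_of_lt_of_le (by positivity) hr
  have hB : 8 * (a / b) ≤ b * r ^ 2 := by
    rw [div_le_iff₀ hb] at hr
    have hsq := pow_le_pow_left₀ (by positivity) hr 2
    rw [mul_pow, Real.sq_sqrt (by positivity)] at hsq
    rw [← mul_div_assoc, div_le_iff₀ hb]
    linarith
  have key := abs_sqrt_sq_sub_four_mul_le (div_pos ha hb) hB
  have hdisc : (b * r ^ 2) ^ 2 - 4 * (a / b * (b * r ^ 2)) = b ^ 2 * r ^ 4 - 4 * a * r ^ 2 := by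
    field_simp
  have hrhs : 8 * (a / b) ^ 2 / (b * r ^ 2) = 8 * a ^ 2 / (b ^ 3 * r ^ 2) := by
    field_simp
  rwa [hdisc, hrhs, ← hγp] at key
end

section
/- Let a, b > 0 and r ≥ 2√(2a)/b, and set γ₋ = (−b r² − √(b²r⁴ − 4a r²))/2 (which is real since b²r² ≥ 8a > 4a). Then |γ₋ + b r² − a/b| ≤ 8a²/(b³ r²). -/
/-- Two-sided second-order bounds for `√(x² − 4cx)` when `x ≥ 8c`. -/
theorem sqrt_sq_sub_four_mul_bounds {c x : ℝ} (hc : 0 < c) (hx : 8 * c ≤ x) :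
    x - 2 * c - 16 * c ^ 2 / x ≤ √(x ^ 2 - 4 * c * x) ∧ √(x ^ 2 - 4 * c * x) ≤ x - 2 * c := by
  have hx0 : 0 < x := by linarith
  constructor
  · apply Real.le_sqrt_of_sq_le
    have ht0 : 0 ≤ 16 * c ^ 2 / x := by positivity
    have ht : 16 * c ^ 2 / x ≤ 2 * c := by
      rw [div_le_iff₀ hx0]
      nlinarith
    have htx : 16 * c ^ 2 / x * x = 16 * c ^ 2 := div_mul_cancel₀ _ hx0.ne'
    generalize 16 * c ^ 2 / x = t at *
    nlinarith [mul_le_mul ht ht ht0 (by positivity), mul_le_mul_of_nonneg_left ht hc.le]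
  · apply Real.sqrt_le_iff.mpr
    constructor <;> nlinarith

/-- Quantitative high-frequency Laurent expansion of the smaller characteristic eigenvalue:
for `r ≥ 2√(2a)/b` and `γ₋ = (−b r² − √(b²r⁴ − 4a r²))/2`, one has
`|γ₋ + b r² − a/b| ≤ 8a²/(b³ r²)`. -/
theorem stmt7 (a b r : ℝ) (ha : 0 < a) (hb : 0 < b)
    (hr : 2 * Real.sqrt (2 * a) / b ≤ r)
    (γm : ℝ)
    (hγm : γm = (-(b * r ^ 2) - Real.sqrt (b ^ 2 * r ^ 4 - 4 * a * r ^ 2)) / 2) :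
    |γm + b * r ^ 2 - a / b| ≤ 8 * a ^ 2 / (b ^ 3 * r ^ 2) := by
  have hrb : 2 * √(2 * a) ≤ r * b := (div_le_iff₀ hb).mp hr
  have hsq : 8 * a ≤ b ^ 2 * r ^ 2 := by
    have h := pow_le_pow_left₀ (by positivity) hrb 2
    rw [mul_pow, Real.sq_sqrt (by positivity)] at h
    linarith
  have hr0 : 0 < r := lt_of_lt_of_le (by positivity) hr
  have hx : 8 * (a / b) ≤ b * r ^ 2 := by
    rw [← mul_div_assoc, div_le_iff₀ hb]
    linarith
  obtain ⟨hlo, hhi⟩ := sqrt_sq_sub_four_mul_bounds (div_pos ha hb) hx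
  have hD : (b * r ^ 2) ^ 2 - 4 * (a / b) * (b * r ^ 2) = b ^ 2 * r ^ 4 - 4 * a * r ^ 2 := by
    field_simp
  have hE : 16 * (a / b) ^ 2 / (b * r ^ 2) = 2 * (8 * a ^ 2 / (b ^ 3 * r ^ 2)) := by
    field_simp
    ring
  rw [hD] at hlo hhi
  rw [hE] at hlo
  have hpos : 0 ≤ 8 * a ^ 2 / (b ^ 3 * r ^ 2) := by positivity
  rw [hγm, abs_le]
  constructor <;> linarith
end

section
/- Let a, b > 0 and 0 < r < 2√a/b, set q = r², θ₁ = √(a q − b²q²/4) > 0 and θ₂ = b q/(2θ₁). Then for all t ≥ 0, |cos(θ₁ t) + θ₂ sin(θ₁ t)| · e^{−b q t/2} ≤ 2·e^{−b q t/4}. -/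
theorem abs_cos_add_mul_sin_le (θ₁ θ₂ t : ℝ) :
    |Real.cos (θ₁ * t) + θ₂ * Real.sin (θ₁ * t)| ≤ 1 + |θ₁ * θ₂ * t| :=
  calc |Real.cos (θ₁ * t) + θ₂ * Real.sin (θ₁ * t)|
      ≤ |Real.cos (θ₁ * t)| + |θ₂| * |Real.sin (θ₁ * t)| := by
        rw [← abs_mul]
        exact abs_add_le _ _
    _ ≤ 1 + |θ₂| * |θ₁ * t| :=
        add_le_add (Real.abs_cos_le_one _)
          (mul_le_mul_of_nonneg_left Real.abs_sin_le_abs (abs_nonneg _))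
    _ = 1 + |θ₁ * θ₂ * t| := by
        rw [← abs_mul]
        ring_nf

theorem one_add_half_mul_exp_neg_half_le (s : ℝ) :
    (1 + s / 2) * Real.exp (-s / 2) ≤ 2 * Real.exp (-s / 4) :=
  calc (1 + s / 2) * Real.exp (-s / 2)
      ≤ 2 * Real.exp (s / 4) * Real.exp (-s / 2) := by
        gcongr
        linarith [Real.add_one_le_exp (s / 4)]
    _ = 2 * Real.exp (-s / 4) := by
        rw [mul_assoc, ← Real.exp_add]
        ring_nf

/-- Uniform bound on the Green-matrix entry `𝒢₁₁` in the oscillatory regime: for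
`0 < r < 2√a/b`, `q = r²`, `θ₁ = √(aq − b²q²/4)`, `θ₂ = bq/(2θ₁)`, one has, for all `t ≥ 0`,
`|cos(θ₁ t) + θ₂ sin(θ₁ t)| e^{−bqt/2} ≤ 2 e^{−bqt/4}`. -/
theorem stmt17 (a b r : ℝ) (ha : 0 < a) (hb : 0 < b) (hr : 0 < r)
    (hr2 : r < 2 * Real.sqrt a / b)
    (q θ₁ θ₂ : ℝ) (hq : q = r ^ 2)
    (hθ₁ : θ₁ = Real.sqrt (a * q - b ^ 2 * q ^ 2 / 4))
    (hθ₂ : θ₂ = b * q / (2 * θ₁)) :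
    ∀ t : ℝ, 0 ≤ t →
      |Real.cos (θ₁ * t) + θ₂ * Real.sin (θ₁ * t)| * Real.exp (-(b * q * t) / 2) ≤
        2 * Real.exp (-(b * q * t) / 4) := by
  intro t ht
  have hq0 : 0 < q := hq ▸ pow_pos hr 2
  have hdisc : 0 < a * q - b ^ 2 * q ^ 2 / 4 := by
    have h : r * b < 2 * Real.sqrt a := (lt_div_iff₀ hb).mp hr2
    have hsq : (r * b) ^ 2 < (2 * Real.sqrt a) ^ 2 := pow_lt_pow_left₀ h (by positivity) two_ne_zero
    rw [mul_pow, mul_pow, Real.sq_sqrt ha.le, ← hq] at hsq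
    nlinarith [mul_pos hq0 (sub_pos.mpr hsq)]
  have hθ₁0 : 0 < θ₁ := hθ₁ ▸ Real.sqrt_pos.mpr hdisc
  have hprod : θ₁ * θ₂ * t = b * q * t / 2 := by
    rw [hθ₂]
    field_simp
  have hosc := abs_cos_add_mul_sin_le θ₁ θ₂ t
  have hs : 0 ≤ b * q * t / 2 := by positivity
  rw [hprod, abs_of_nonneg hs] at hosc
  exact (mul_le_mul_of_nonneg_right hosc (Real.exp_pos _).le).trans
    (one_add_half_mul_exp_neg_half_le (b * q * t))
end
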